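/- Let G be a δ-hyperbolic group with respect to a finite symmetrized generating set 𝒜. Let λ̄ > 0, c̄ ≥ 0, C_0 ≥ 14δ, and C_1 = 12(C_0 + δ) + c̄ + 1 be given. Then for λ = λ̄/4 > 0 there exists c = c(λ̄, c̄, C_0) ≥ 0 such that: for any N ∈ ℕ, any points x_0, x_1, ..., x_N ∈ Γ(G,𝒜), and any (λ̄, c̄)-quasigeodesic paths q_i from x_{i−1} to x_i (i = 1, ..., N), if ‖q_i‖ ≥ (C_1 + c̄)/λ̄ for all i and (x_{i−1} | x_{i+1})_{x_i} ≤ C_0 for all i = 1, ..., N−1, then the concatenation q = q_1 q_2 ⋯ q_N is a (λ, c)-quasigeodesic path. -/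

import Mathlib

open scoped Pointwise

/-- `S` is a finite symmetrized generating set of the group `G`. -/
def IsSymmGenSet {G : Type*} [Group G] (S : Set G) : Prop :=
  S.Finite ∧ S⁻¹ = S ∧ Subgroup.closure S = ⊤

/-- The word length of `g` with respect to the generating set `S`: the length of a
shortest word over `S` representing `g`. -/
noncomputable def wordLength {G : Type*} [Group G] (S : Set G) (g : G) : ℕ :=
  sInf {n : ℕ | ∃ f : Fin n → G, (∀ i, f i ∈ S) ∧ (List.ofFn f).prod = g}

/-- The left-invariant word metric `d(x,y) = |x⁻¹y|_G` on `G`. -/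
noncomputable def wordDist {G : Type*} [Group G] (S : Set G) (x y : G) : ℕ :=
  wordLength S (x⁻¹ * y)

/-- The Gromov product `(x|y)_w = (d(x,w)+d(y,w)-d(x,y))/2`. -/
noncomputable def gromovProd {G : Type*} [Group G] (S : Set G) (x y w : G) : ℝ :=
  ((wordDist S w x : ℝ) + (wordDist S w y : ℝ) - (wordDist S x y : ℝ)) / 2

/-- A discrete geodesic from `u` to `v` in the Cayley graph `Γ(G,S)`: a sequence of
vertices `p 0 = u, ..., p (d(u,v)) = v` with `d(p i, p j) = j - i`. -/
def IsGeodesic {G : Type*} [Group G] (S : Set G) (u v : G) (p : ℕ → G) : Prop :=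
  p 0 = u ∧ p (wordDist S u v) = v ∧
    ∀ i j : ℕ, i ≤ j → j ≤ wordDist S u v → wordDist S (p i) (p j) = j - i

/-- A subset `Q ⊆ G` is `ε`-quasiconvex if every geodesic between two elements of `Q`
lies in the closed `ε`-neighborhood of `Q`. -/
def IsQuasiconvex {G : Type*} [Group G] (S : Set G) (ε : ℝ) (Q : Set G) : Prop :=
  ∀ u ∈ Q, ∀ v ∈ Q, ∀ p : ℕ → G, IsGeodesic S u v p →
    ∀ i ≤ wordDist S u v, ∃ q ∈ Q, (wordDist S (p i) q : ℝ) ≤ ε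

/-- All geodesic triangles in `Γ(G,S)` are `δ`-thin: two points on the sides of a
geodesic triangle, equidistant from a common vertex (within the Gromov product),
are at distance at most `δ` from each other. -/
def ThinTriangles {G : Type*} [Group G] (S : Set G) (δ : ℝ) : Prop :=
  ∀ a b c : G, ∀ p q : ℕ → G, IsGeodesic S a b p → IsGeodesic S a c q →
    ∀ i : ℕ, (i : ℝ) ≤ gromovProd S b c a → (wordDist S (p i) (q i) : ℝ) ≤ δ

/-- The profinite topology on `G`: cosets of finite index normal subgroups form a
basis of open sets (equivalently, a basis of neighborhoods of the identity). -/
def profiniteTopology (G : Type*) [Group G] : TopologicalSpace G :=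
  TopologicalSpace.generateFrom
    {U : Set G | ∃ (g : G) (N : Subgroup G), N.Normal ∧ N.FiniteIndex ∧ U = g • (N : Set G)}

/-- A subset of `G` is separable if it is closed in the profinite topology on `G`. -/
def SeparableSubset (G : Type*) [Group G] (P : Set G) : Prop :=
  @IsClosed G (profiniteTopology G) P

/-- A word hyperbolic group `G` (with finite symmetrized generating set `S`) is GFERF
if every quasiconvex subgroup of `G` is separable. -/
def GFERF {G : Type*} [Group G] (S : Set G) : Prop :=
  ∀ H : Subgroup G, (∃ ε : ℝ, 0 ≤ ε ∧ IsQuasiconvex S ε (H : Set G)) →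
    SeparableSubset G (H : Set G)

/-- A `(λ,c)`-quasigeodesic path of length `n` in the Cayley graph `Γ(G,S)`:
consecutive vertices are adjacent and every subpath `p|_{[i,j]}` satisfies
`λ(j-i) - c ≤ d(p i, p j)`. -/
def IsQuasigeodesicOn {G : Type*} [Group G] (S : Set G) (lam c : ℝ) (p : ℕ → G) (n : ℕ) : Prop :=
  (∀ i < n, wordDist S (p i) (p (i + 1)) = 1) ∧
    ∀ i j : ℕ, i ≤ j → j ≤ n → lam * ((j : ℝ) - (i : ℝ)) - c ≤ (wordDist S (p i) (p j) : ℝ)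

section WordMetric

variable {G : Type*} [Group G] {S : Set G}

theorem wordLength_prod_le (l : List G) (hl : ∀ s ∈ l, s ∈ S) :
    wordLength S l.prod ≤ l.length :=
  Nat.sInf_le ⟨l.get, fun i => hl _ (l.get_mem i), by rw [List.ofFn_get]⟩

theorem exists_word (hS : IsSymmGenSet S) (g : G) :
    ∃ l : List G, (∀ s ∈ l, s ∈ S) ∧ l.prod = g ∧ l.length = wordLength S g := by
  have hne : {n : ℕ | ∃ f : Fin n → G, (∀ i, f i ∈ S) ∧ (List.ofFn f).prod = g}.Nonempty := by
    have hg : g ∈ (Subgroup.closure S).toSubmonoid := hS.2.2 ▸ Subgroup.mem_top g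
    rw [Subgroup.closure_toSubmonoid, hS.2.1, Set.union_self] at hg
    obtain ⟨l, hl, hprod⟩ := Submonoid.exists_list_of_mem_closure hg
    exact ⟨l.length, l.get, fun i => hl _ (l.get_mem i), by rw [List.ofFn_get, hprod]⟩
  obtain ⟨f, hf, hprod⟩ := Nat.sInf_mem hne
  refine ⟨List.ofFn f, fun s hs => ?_, hprod, by rw [List.length_ofFn]; rfl⟩
  obtain ⟨i, rfl⟩ := (List.mem_ofFn' f s).1 hs
  exact hf i

theorem wordDist_self (x : G) : wordDist S x x = 0 := by
  have h := wordLength_prod_le (S := S) [] (by simp)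
  simpa [wordDist] using h

theorem eq_of_wordDist_eq_zero (hS : IsSymmGenSet S) {x y : G} (h : wordDist S x y = 0) :
    x = y := by
  obtain ⟨l, -, hprod, hlen⟩ := exists_word hS (x⁻¹ * y)
  have hl : l = [] := List.length_eq_zero_iff.1 (hlen.trans h)
  rw [hl, List.prod_nil] at hprod
  exact (inv_mul_eq_one.1 hprod.symm)

theorem wordDist_triangle (hS : IsSymmGenSet S) (x y z : G) :
    wordDist S x z ≤ wordDist S x y + wordDist S y z := by
  obtain ⟨l, hl, hprod, hlen⟩ := exists_word hS (x⁻¹ * y)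
  obtain ⟨m, hm, hprod', hlen'⟩ := exists_word hS (y⁻¹ * z)
  have h := wordLength_prod_le (S := S) (l ++ m) (by
    intro s hs
    rcases List.mem_append.1 hs with hs | hs
    exacts [hl s hs, hm s hs])
  rw [List.prod_append, hprod, hprod', List.length_append, hlen, hlen'] at h
  have e : x⁻¹ * y * (y⁻¹ * z) = x⁻¹ * z := by group
  rw [e] at h
  exact h

theorem wordDist_le_swap (hS : IsSymmGenSet S) (x y : G) : wordDist S y x ≤ wordDist S x y := by
  obtain ⟨l, hl, hprod, hlen⟩ := exists_word hS (x⁻¹ * y)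
  have h := wordLength_prod_le (S := S) (l.map (·⁻¹)).reverse (by
    intro s hs
    obtain ⟨t, ht, rfl⟩ := List.mem_map.1 (List.mem_reverse.1 hs)
    rw [← hS.2.1]
    simpa using hl t ht)
  rw [← List.prod_inv_reverse, hprod, List.length_reverse, List.length_map, hlen] at h
  have e : (x⁻¹ * y)⁻¹ = y⁻¹ * x := by group
  rw [e] at h
  exact h

theorem wordDist_comm (hS : IsSymmGenSet S) (x y : G) : wordDist S x y = wordDist S y x :=
  le_antisymm (wordDist_le_swap hS y x) (wordDist_le_swap hS x y)

theorem exists_isGeodesic (hS : IsSymmGenSet S) (u v : G) : ∃ p : ℕ → G, IsGeodesic S u v p := by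
  obtain ⟨l, hl, hprod, hlen⟩ := exists_word hS (u⁻¹ * v)
  have hlen' : l.length = wordDist S u v := hlen
  have hend : u * (l.take (wordDist S u v)).prod = v := by
    rw [← hlen', List.take_length, hprod]
    group
  have hle : ∀ i j, i ≤ j → j ≤ wordDist S u v →
      wordDist S (u * (l.take i).prod) (u * (l.take j).prod) ≤ j - i := by
    intro i j hij hj
    have e : (u * (l.take i).prod)⁻¹ * (u * (l.take j).prod) = ((l.take j).drop i).prod := by
      have h := List.prod_take_mul_prod_drop (l.take j) i
      rw [List.take_take, min_eq_left hij] at h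
      rw [← h]
      group
    have h := wordLength_prod_le (S := S) ((l.take j).drop i)
      fun s hs => hl s (List.mem_of_mem_take (List.mem_of_mem_drop hs))
    rw [← e, List.length_drop, List.length_take, hlen', min_eq_left hj] at h
    exact h
  refine ⟨fun i => u * (l.take i).prod, by simp, hend, fun i j hij hj => ?_⟩
  have h0 := hle 0 i (Nat.zero_le _) (hij.trans hj)
  have h1 := hle i j hij hj
  have h2 := hle j _ hj le_rfl
  rw [hend] at h2
  have e0 : u * (l.take 0).prod = u := by simp
  rw [e0] at h0
  have h3 := wordDist_triangle hS u (u * (l.take i).prod) v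
  have h4 := wordDist_triangle hS (u * (l.take i).prod) (u * (l.take j).prod) v
  dsimp only
  omega

theorem IsGeodesic.dist_left {u v : G} {p : ℕ → G} (hp : IsGeodesic S u v p) {i : ℕ}
    (hi : i ≤ wordDist S u v) : wordDist S u (p i) = i := by
  have h := hp.2.2 0 i (Nat.zero_le _) hi
  rwa [hp.1, Nat.sub_zero] at h

theorem IsGeodesic.dist_right {u v : G} {p : ℕ → G} (hp : IsGeodesic S u v p) {i : ℕ}
    (hi : i ≤ wordDist S u v) : wordDist S (p i) v = wordDist S u v - i := by
  have h := hp.2.2 i _ hi le_rfl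
  rwa [hp.2.1] at h

theorem wordDist_le_of_steps (hS : IsSymmGenSet S) {p : ℕ → G} {n : ℕ}
    (hp : ∀ i < n, wordDist S (p i) (p (i + 1)) = 1) {i j : ℕ} (hij : i ≤ j) (hj : j ≤ n) :
    wordDist S (p i) (p j) ≤ j - i := by
  induction j, hij using Nat.le_induction with
  | base => simp [wordDist_self]
  | succ j hij ih =>
    have h := wordDist_triangle hS (p i) (p j) (p (j + 1))
    have h1 := hp j hj
    have h2 := ih (by omega)
    omega

theorem wordDist_comm_real (hS : IsSymmGenSet S) (x y : G) :
    (wordDist S x y : ℝ) = wordDist S y x := by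
  rw [wordDist_comm hS]

theorem wordDist_triangle_real (hS : IsSymmGenSet S) (x y z : G) :
    (wordDist S x z : ℝ) ≤ wordDist S x y + wordDist S y z := by
  exact_mod_cast wordDist_triangle hS x y z

end WordMetric

section GromovProduct

variable {G : Type*} [Group G] {S : Set G}

/-- The four-point form of Gromov hyperbolicity with constant `η`. -/
def FourPointHyperbolic {G : Type*} [Group G] (S : Set G) (η : ℝ) : Prop :=
  ∀ x y z w : G, min (gromovProd S x y w) (gromovProd S y z w) ≤ gromovProd S x z w + η

theorem gromovProd_comm (hS : IsSymmGenSet S) (x y w : G) :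
    gromovProd S x y w = gromovProd S y x w := by
  simp only [gromovProd, wordDist_comm_real hS x y]
  ring

theorem gromovProd_le_left (hS : IsSymmGenSet S) (x y w : G) :
    gromovProd S x y w ≤ wordDist S w x := by
  have h := wordDist_triangle_real hS w x y
  simp only [gromovProd]
  linarith

theorem gromovProd_nonneg (hS : IsSymmGenSet S) (x y w : G) : 0 ≤ gromovProd S x y w := by
  have h := wordDist_triangle_real hS x w y
  rw [wordDist_comm_real hS x w] at h
  simp only [gromovProd]
  linarith

theorem gromovProd_add_swap (hS : IsSymmGenSet S) (x y w : G) :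
    gromovProd S x y w + gromovProd S x w y = wordDist S w y := by
  simp only [gromovProd, wordDist_comm_real hS y w, wordDist_comm_real hS y x,
    wordDist_comm_real hS w x]
  ring

theorem gromovProd_le_add (hS : IsSymmGenSet S) (x y w v : G) :
    gromovProd S x y w ≤ gromovProd S x y v + wordDist S w v := by
  have h := wordDist_triangle_real hS w v x
  have h' := wordDist_triangle_real hS w v y
  simp only [gromovProd]
  linarith

/-- If `y` is almost between `u` and `v`, then replacing `u` by `y` almost preserves an upper
bound on a Gromov product based at `v`. -/
theorem gromovProd_le_of_near (hS : IsSymmGenSet S) {η C H : ℝ} (hη : FourPointHyperbolic S η)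
    (hH : 0 ≤ H) {u v y z : G} (hy : gromovProd S u v y ≤ H) (hz : gromovProd S u z v ≤ C) :
    gromovProd S y z v ≤ C + η + H := by
  have h := hη u y z v
  have h1 := gromovProd_add_swap hS u v y
  have h2 := gromovProd_le_left hS y z v
  rw [wordDist_comm_real hS v y] at h2
  rcases min_le_iff.1 h with h | h <;> linarith

/-- Local-to-global for Gromov products along a broken line with long pieces. -/
theorem gromovProd_broken_line (hS : IsSymmGenSet S) {η C₀ : ℝ} (hη0 : 0 ≤ η)
    (hη : FourPointHyperbolic S η) (x : ℕ → G) (M : ℕ)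
    (hlen : ∀ k < M, 2 * (C₀ + η) < wordDist S (x k) (x (k + 1)))
    (hprod : ∀ k, k + 2 ≤ M → gromovProd S (x k) (x (k + 2)) (x (k + 1)) ≤ C₀) (k : ℕ)
    (hk : k + 2 ≤ M) : gromovProd S (x 0) (x (k + 2)) (x (k + 1)) ≤ C₀ + η := by
  induction k with
  | zero =>
    have := hprod 0 hk
    linarith
  | succ k ih =>
    have h1 := ih (by omega)
    have h2 := gromovProd_add_swap hS (x 0) (x (k + 1)) (x (k + 2))
    have h3 := hlen (k + 1) (by omega)
    have h4 := hη (x (k + 1)) (x 0) (x (k + 3)) (x (k + 2))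
    have h5 := hprod (k + 1) hk
    have e1 : k + 1 + 1 = k + 2 := by omega
    have e2 : k + 1 + 2 = k + 3 := by omega
    rw [e1] at h3 h5 ⊢
    rw [e2] at h5 ⊢
    rw [gromovProd_comm hS (x (k + 1)) (x 0)] at h4
    rw [wordDist_comm_real hS] at h3
    rcases min_le_iff.1 h4 with h | h <;> linarith

theorem gromovProd_broken_line_reverse (hS : IsSymmGenSet S) {η C₀ : ℝ} (hη0 : 0 ≤ η)
    (hη : FourPointHyperbolic S η) (x : ℕ → G) (M : ℕ)
    (hlen : ∀ k < M, 2 * (C₀ + η) < wordDist S (x k) (x (k + 1)))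
    (hprod : ∀ k, k + 2 ≤ M → gromovProd S (x k) (x (k + 2)) (x (k + 1)) ≤ C₀)
    (hM : 2 ≤ M) : gromovProd S (x 0) (x M) (x 1) ≤ C₀ + η := by
  have h := gromovProd_broken_line (C₀ := C₀) hS hη0 hη (fun i => x (M - i)) M ?_ ?_ (M - 2)
    (by omega)
  · have e1 : M - (M - 2 + 2) = 0 := by omega
    have e2 : M - (M - 2 + 1) = 1 := by omega
    simp only [e1, e2, Nat.sub_zero] at h
    rwa [gromovProd_comm hS] at h
  · intro k hk
    have h := hlen (M - (k + 1)) (by omega)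
    have e : M - (k + 1) + 1 = M - k := by omega
    rw [e, wordDist_comm_real hS] at h
    exact h
  · intro k hk
    have h := hprod (M - (k + 2)) (by omega)
    have e : M - (k + 2) + 1 = M - (k + 1) := by omega
    have e' : M - (k + 2) + 2 = M - k := by omega
    rw [e, e', gromovProd_comm hS] at h
    exact h

end GromovProduct

section ThinToFourPoint

variable {G : Type*} [Group G] {S : Set G} {δ : ℝ}

theorem ThinTriangles.fourPoint_add_half (hS : IsSymmGenSet S) (hhyp : ThinTriangles S δ) :
    FourPointHyperbolic S (δ + 1 / 2) := by
  intro x y z w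
  obtain ⟨p, hp⟩ := exists_isGeodesic hS w x
  obtain ⟨q, hq⟩ := exists_isGeodesic hS w y
  obtain ⟨r, hr⟩ := exists_isGeodesic hS w z
  have hx := gromovProd_le_left hS x y w
  have hz := gromovProd_le_left hS z y w
  have n1 := gromovProd_nonneg hS x y w
  have n2 := gromovProd_nonneg hS y z w
  rw [gromovProd_comm hS z y] at hz
  -- twice the minimum, as a natural number
  obtain ⟨m, hm⟩ : ∃ m : ℕ, (m : ℝ) = 2 * min (gromovProd S x y w) (gromovProd S y z w) := by
    have t1 := wordDist_triangle hS x w y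
    have t2 := wordDist_triangle hS y w z
    rw [wordDist_comm hS x w] at t1
    rw [wordDist_comm hS y w] at t2
    rcases min_choice (gromovProd S x y w) (gromovProd S y z w) with h | h
    · refine ⟨wordDist S w x + wordDist S w y - wordDist S x y, ?_⟩
      rw [h, Nat.cast_sub t1]
      simp only [gromovProd]
      push_cast
      ring
    · refine ⟨wordDist S w y + wordDist S w z - wordDist S y z, ?_⟩
      rw [h, Nat.cast_sub t2]
      simp only [gromovProd]
      push_cast
      ring
  have l1 := min_le_left (gromovProd S x y w) (gromovProd S y z w)
  have l2 := min_le_right (gromovProd S x y w) (gromovProd S y z w)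
  obtain ⟨i, hi⟩ : ∃ i : ℕ, i = m / 2 := ⟨_, rfl⟩
  have hi1 : (2 * i : ℝ) ≤ m := by exact_mod_cast (by omega : 2 * i ≤ m)
  have hi2 : (m : ℝ) ≤ 2 * i + 1 := by exact_mod_cast (by omega : m ≤ 2 * i + 1)
  have d1 := hhyp w x y p q hp hq i (by linarith)
  have d2 := hhyp w y z q r hq hr i (by linarith)
  have ix : i ≤ wordDist S w x := by
    have : (i : ℝ) ≤ wordDist S w x := by linarith
    exact_mod_cast this
  have iz : i ≤ wordDist S w z := by
    have : (i : ℝ) ≤ wordDist S w z := by linarith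
    exact_mod_cast this
  have e1 : (wordDist S (p i) x : ℝ) = wordDist S w x - i := by
    rw [hp.dist_right ix, Nat.cast_sub ix]
  have e2 : (wordDist S (r i) z : ℝ) = wordDist S w z - i := by
    rw [hr.dist_right iz, Nat.cast_sub iz]
  have t1 := wordDist_triangle_real hS x (p i) z
  have t2 := wordDist_triangle_real hS (p i) (q i) z
  have t3 := wordDist_triangle_real hS (q i) (r i) z
  rw [wordDist_comm_real hS x (p i)] at t1
  have : gromovProd S x z w ≥ i - δ := by
    simp only [gromovProd]
    linarith
  linarith

/-- With thinness constant below `1`, equidistant points on two sides coincide. -/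
theorem ThinTriangles.eq_of_lt_one (hS : IsSymmGenSet S) (hhyp : ThinTriangles S δ) (h1 : δ < 1)
    {a b c : G} {p q : ℕ → G} (hp : IsGeodesic S a b p) (hq : IsGeodesic S a c q) {i : ℕ}
    (hi : (i : ℝ) ≤ gromovProd S b c a) : p i = q i := by
  have h := (hhyp a b c p q hp hq i hi).trans_lt h1
  have h' : wordDist S (p i) (q i) < 1 := by exact_mod_cast h
  exact eq_of_wordDist_eq_zero hS (by omega)

theorem ThinTriangles.between_of_lt_one (hS : IsSymmGenSet S) (hhyp : ThinTriangles S δ)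
    (h1 : δ < 1) {x y z v : G} (hv : wordDist S x v + wordDist S v z = wordDist S x z)
    (hle : (wordDist S x v : ℝ) ≤ gromovProd S z y x) :
    wordDist S x v + wordDist S v y = wordDist S x y := by
  obtain ⟨p, hp⟩ := exists_isGeodesic hS x z
  obtain ⟨q, hq⟩ := exists_isGeodesic hS x v
  obtain ⟨r, hr⟩ := exists_isGeodesic hS x y
  have hv' : (wordDist S x v : ℝ) + wordDist S v z = wordDist S x z := by exact_mod_cast hv
  have e1 := hhyp.eq_of_lt_one hS h1 hq hp (i := wordDist S x v) (by
    simp only [gromovProd]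
    linarith)
  have e2 := hhyp.eq_of_lt_one hS h1 hp hr hle
  rw [hq.2.1] at e1
  have hy : wordDist S x v ≤ wordDist S x y := by
    have h := gromovProd_le_left hS y z x
    rw [gromovProd_comm hS] at h
    exact_mod_cast hle.trans h
  have h := hr.dist_right hy
  rw [← e2, ← e1] at h
  omega

theorem ThinTriangles.fourPoint_zero_of_lt_one (hS : IsSymmGenSet S) (hhyp : ThinTriangles S δ)
    (h1 : δ < 1) : FourPointHyperbolic S 0 := by
  intro x y z w
  by_contra hcon
  rw [not_le, add_zero, lt_min_iff] at hcon
  obtain ⟨hc1, hc2⟩ := hcon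
  obtain ⟨p, hp⟩ := exists_isGeodesic hS w x
  obtain ⟨q, hq⟩ := exists_isGeodesic hS w y
  obtain ⟨r, hr⟩ := exists_isGeodesic hS w z
  have tx := wordDist_triangle hS w x y
  have ty := wordDist_triangle hS w y x
  have tz := wordDist_triangle hS w z y
  have s1 := wordDist_triangle hS x w y
  have s2 := wordDist_triangle hS y w z
  rw [wordDist_comm hS x w] at s1
  rw [wordDist_comm hS y w] at s2
  rw [wordDist_comm hS y x] at ty
  rw [wordDist_comm hS z y] at tz
  have hc1' : wordDist S w z + wordDist S x y < wordDist S w y + wordDist S x z := by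
    simp only [gromovProd] at hc1
    have : (wordDist S w z : ℝ) + wordDist S x y < wordDist S w y + wordDist S x z := by linarith
    exact_mod_cast this
  have hc2' : wordDist S w x + wordDist S y z < wordDist S w y + wordDist S x z := by
    simp only [gromovProd] at hc2
    have : (wordDist S w x : ℝ) + wordDist S y z < wordDist S w y + wordDist S x z := by linarith
    exact_mod_cast this
  obtain ⟨i, hi⟩ : ∃ i : ℕ, i = min (wordDist S w x + wordDist S w y - wordDist S x y)
    (wordDist S w y + wordDist S w z - wordDist S y z) / 2 := ⟨_, rfl⟩
  have i1 : 2 * i + wordDist S x y ≤ wordDist S w x + wordDist S w y := by omega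
  have i2 : 2 * i + wordDist S y z ≤ wordDist S w y + wordDist S w z := by omega
  have epq := hhyp.eq_of_lt_one hS h1 hp hq (i := i) (by
    simp only [gromovProd]
    have : (2 * i : ℝ) + wordDist S x y ≤ wordDist S w x + wordDist S w y := by exact_mod_cast i1
    linarith)
  have eqr := hhyp.eq_of_lt_one hS h1 hq hr (i := i) (by
    simp only [gromovProd]
    have : (2 * i : ℝ) + wordDist S y z ≤ wordDist S w y + wordDist S w z := by exact_mod_cast i2
    linarith)
  have dx := hp.dist_right (i := i) (by omega)
  have dy := hq.dist_right (i := i) (by omega)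
  have dz := hr.dist_right (i := i) (by omega)
  rw [← eqr, ← epq] at dz
  rw [← epq] at dy
  have t := wordDist_triangle hS x (p i) z
  have cx := wordDist_comm hS x (p i)
  have cz := wordDist_comm hS z (p i)
  have cxz := wordDist_comm hS z x
  have cyz := wordDist_comm hS z y
  have hv : wordDist S x (p i) + wordDist S (p i) z = wordDist S x z := by omega
  rcases le_total (wordDist S y z + wordDist S x (p i)) (wordDist S x y + wordDist S (p i) z)
    with h | h
  · have hb := hhyp.between_of_lt_one hS h1 (y := y) hv (by
      simp only [gromovProd, wordDist_comm_real hS z y]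
      have hr' : (wordDist S y z : ℝ) + wordDist S x (p i) ≤
        wordDist S x y + wordDist S (p i) z := by exact_mod_cast h
      have hv' : (wordDist S x (p i) : ℝ) + wordDist S (p i) z = wordDist S x z := by
        exact_mod_cast hv
      linarith)
    omega
  · have hv2 : wordDist S z (p i) + wordDist S (p i) x = wordDist S z x := by omega
    have hb := hhyp.between_of_lt_one hS h1 (y := y) hv2 (by
      simp only [gromovProd]
      have hr' : (wordDist S x y : ℝ) + wordDist S z (p i) ≤
        wordDist S z y + wordDist S (p i) x := by exact_mod_cast (by omega)
      have hv' : (wordDist S z (p i) : ℝ) + wordDist S (p i) x = wordDist S z x := by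
        exact_mod_cast hv2
      linarith)
    omega

theorem ThinTriangles.fourPoint (hS : IsSymmGenSet S) (hδ : 0 ≤ δ) (hhyp : ThinTriangles S δ) :
    FourPointHyperbolic S (2 * δ) := by
  intro x y z w
  rcases lt_or_ge δ 1 with h | h
  · have := hhyp.fourPoint_zero_of_lt_one hS h x y z w
    linarith
  · have := hhyp.fourPoint_add_half hS x y z w
    linarith

end ThinToFourPoint

section Morse

variable {G : Type*} [Group G] {S : Set G} {η : ℝ}

/-- A path of length at most `2 ^ k` avoiding a ball about `w` has endpoints whose Gromov product
at `w` is at least the radius of the ball, up to an error linear in `k`. -/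
theorem le_gromovProd_of_path (hη : FourPointHyperbolic S η) (p : ℕ → G) (w : G) (r : ℝ)
    (k : ℕ) : ∀ a m : ℕ, m ≤ 2 ^ k →
      (∀ i, a ≤ i → i ≤ a + m → r ≤ wordDist S w (p i)) →
      (∀ i, a ≤ i → i < a + m → wordDist S (p i) (p (i + 1)) = 1) →
      r - 1 / 2 - k * η ≤ gromovProd S (p a) (p (a + m)) w := by
  induction k with
  | zero =>
    intro a m hm hr hs
    have h1 := hr a le_rfl (by omega)
    have h2 := hr (a + m) (by omega) le_rfl
    have h3 : (wordDist S (p a) (p (a + m)) : ℝ) ≤ 1 := by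
      rcases Nat.le_one_iff_eq_zero_or_eq_one.1 (by simpa using hm) with rfl | rfl
      · simp [wordDist_self]
      · simp [hs a le_rfl (by omega)]
    simp only [gromovProd, Nat.cast_zero]
    linarith
  | succ k ih =>
    intro a m hm hr hs
    rw [pow_succ] at hm
    have h1 := ih a (m / 2) (by omega) (fun i h h' => hr i h (by omega))
      (fun i h h' => hs i h (by omega))
    have h2 := ih (a + m / 2) (m - m / 2) (by omega) (fun i h h' => hr i (by omega) (by omega))
      (fun i h h' => hs i (by omega) (by omega))
    have e : a + m / 2 + (m - m / 2) = a + m := by omega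
    rw [e] at h2
    have h := hη (p a) (p (a + m / 2)) (p (a + m)) w
    push_cast
    rcases min_le_iff.1 h with h | h <;> linarith

theorem exists_bound_of_log_bound (η lamb cb : ℝ) (hlamb : 0 < lamb) :
    ∃ H : ℝ, 0 ≤ H ∧ ∀ D : ℕ,
      (∀ k : ℕ, (6 * D + cb) / lamb ≤ 2 ^ k → (D : ℝ) - 1 / 2 ≤ (k + 2) * η) → (D : ℝ) ≤ H := by
  obtain ⟨m, hm⟩ := exists_nat_ge (2 * |η| + 1)
  have hm0 : 0 < m := by
    have : (0 : ℝ) < m := by linarith [abs_nonneg η]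
    exact_mod_cast this
  have hlim : Filter.Tendsto (fun k : ℕ => (6 * m / lamb) * ((k : ℝ) ^ 1 / 2 ^ k) +
      ((6 * m + cb) / lamb) * ((k : ℝ) ^ 0 / 2 ^ k)) Filter.atTop (nhds 0) := by
    have h1 := (tendsto_pow_const_div_const_pow_of_one_lt 1 (one_lt_two (α := ℝ))).const_mul
      (6 * m / lamb)
    have h0 := (tendsto_pow_const_div_const_pow_of_one_lt 0 (one_lt_two (α := ℝ))).const_mul
      ((6 * m + cb) / lamb)
    simpa using h1.add h0
  obtain ⟨K, hK⟩ := Filter.eventually_atTop.1 (hlim.eventually (gt_mem_nhds one_pos))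
  refine ⟨m * (K + 3), by positivity, fun D hD => ?_⟩
  by_contra hlt
  rw [not_le] at hlt
  have hlt' : m * (K + 3) < D := by exact_mod_cast hlt
  have hk : K + 3 ≤ D / m := (Nat.le_div_iff_mul_le hm0).2 (by rw [mul_comm]; exact hlt'.le)
  obtain ⟨k, hkdef⟩ : ∃ k, k = D / m := ⟨_, rfl⟩
  have hk1 : (m : ℝ) * k ≤ D := by
    rw [hkdef]
    exact_mod_cast Nat.mul_div_le D m
  have hk2 : (D : ℝ) ≤ m * (k + 1) := by
    rw [hkdef]
    exact_mod_cast (Nat.lt_mul_div_succ D hm0).le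
  have hpow : (6 * D + cb) / lamb ≤ 2 ^ k := by
    have h := (hK k (by omega)).le
    have hp : (0 : ℝ) < 2 ^ k := by positivity
    have e : (6 * m / lamb) * ((k : ℝ) ^ 1 / 2 ^ k) + ((6 * m + cb) / lamb) *
        ((k : ℝ) ^ 0 / 2 ^ k) = ((6 * (m * (k + 1)) + cb) / lamb) / 2 ^ k := by
      field_simp
      ring
    rw [e, div_le_one hp] at h
    refine le_trans ?_ h
    gcongr
  have h := hD k hpow
  have hη1 : ((k : ℝ) + 2) * η ≤ (k + 2) * ((m - 1) / 2) := by
    gcongr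
    linarith [le_abs_self η]
  have hk3 : (3 : ℝ) ≤ k := by exact_mod_cast (by omega : 3 ≤ k)
  have hm1 : (1 : ℝ) ≤ m := by exact_mod_cast hm0
  nlinarith

/-- Geodesics stay close to quasigeodesics with the same endpoints. -/
theorem exists_geodesic_near_quasigeodesic (hS : IsSymmGenSet S) (hη0 : 0 ≤ η)
    (hη : FourPointHyperbolic S η) (lamb cb : ℝ) (hlamb : 0 < lamb) :
    ∃ H : ℝ, 0 ≤ H ∧ ∀ (p : ℕ → G) (n : ℕ), IsQuasigeodesicOn S lamb cb p n →
      ∀ g : ℕ → G, IsGeodesic S (p 0) (p n) g → ∀ k ≤ wordDist S (p 0) (p n),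
        ∃ i ≤ n, (wordDist S (g k) (p i) : ℝ) ≤ H := by
  obtain ⟨H, hH0, hH⟩ := exists_bound_of_log_bound η lamb cb hlamb
  refine ⟨H, hH0, fun p n hp g hg => ?_⟩
  obtain ⟨L, hL⟩ : ∃ L, L = wordDist S (p 0) (p n) := ⟨_, rfl⟩
  have hnear : ∀ k, ∃ i ≤ n, ∀ j ≤ n, wordDist S (g k) (p i) ≤ wordDist S (g k) (p j) := by
    intro k
    obtain ⟨i, hi, hmin⟩ := Finset.exists_min_image (Finset.range (n + 1))
      (fun i => wordDist S (g k) (p i)) ⟨0, by simp⟩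
    exact ⟨i, by simpa [Nat.lt_succ_iff] using hi,
      fun j hj => hmin j (by simpa [Nat.lt_succ_iff] using hj)⟩
  choose f hfn hf using hnear
  obtain ⟨k₀, hk₀, hmax⟩ := Finset.exists_max_image (Finset.range (L + 1))
    (fun k => wordDist S (g k) (p (f k))) ⟨0, by simp⟩
  have hk₀L : k₀ ≤ L := by simpa [Nat.lt_succ_iff] using hk₀
  obtain ⟨D, hD⟩ : ∃ D, D = wordDist S (g k₀) (p (f k₀)) := ⟨_, rfl⟩
  have hfD : ∀ k ≤ L, wordDist S (g k) (p (f k)) ≤ D := fun k hk => by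
    rw [hD]
    exact hmax k (by simpa [Nat.lt_succ_iff] using hk)
  have hout : ∀ i ≤ n, D ≤ wordDist S (g k₀) (p i) := fun i hi => by
    rw [hD]
    exact hf k₀ i hi
  suffices hDH : (D : ℝ) ≤ H by
    intro k hk
    refine ⟨f k, hfn k, le_trans ?_ hDH⟩
    exact_mod_cast hfD k (hL ▸ hk)
  refine hH D fun k hk => ?_
  -- a point of the geodesic on either side of `g k₀`, and a point of the path near it
  have hleft : ∃ k₁ ≤ k₀, k₀ ≤ k₁ + 2 * D ∧ ∃ a ≤ n, wordDist S (g k₁) (p a) ≤ D ∧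
      (D : ℝ) ≤ gromovProd S (g k₁) (p a) (g k₀) := by
    rcases le_total k₀ (2 * D) with h | h
    · refine ⟨0, Nat.zero_le _, by omega, 0, Nat.zero_le _, ?_, ?_⟩
      · rw [hg.1, wordDist_self]
        exact Nat.zero_le _
      · have h0 : (D : ℝ) ≤ wordDist S (g k₀) (p 0) := by exact_mod_cast hout 0 (Nat.zero_le _)
        simp only [gromovProd, hg.1, wordDist_self, Nat.cast_zero]
        linarith
    · refine ⟨k₀ - 2 * D, by omega, by omega, f _, hfn _, hfD _ (by omega), ?_⟩
      have h1 := hg.2.2 (k₀ - 2 * D) k₀ (by omega) (hL ▸ hk₀L)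
      have h2 : (D : ℝ) ≤ wordDist S (g k₀) (p (f (k₀ - 2 * D))) := by
        exact_mod_cast hout _ (hfn _)
      have h3 : (wordDist S (g (k₀ - 2 * D)) (p (f (k₀ - 2 * D))) : ℝ) ≤ D := by
        exact_mod_cast hfD _ (by omega)
      have h4 : (wordDist S (g k₀) (g (k₀ - 2 * D)) : ℝ) = 2 * D := by
        rw [wordDist_comm hS]
        exact_mod_cast (by omega)
      simp only [gromovProd]
      linarith
  have hright : ∃ k₂ ≤ L, k₀ ≤ k₂ ∧ k₂ ≤ k₀ + 2 * D ∧ ∃ b ≤ n, wordDist S (g k₂) (p b) ≤ D ∧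
      (D : ℝ) ≤ gromovProd S (g k₂) (p b) (g k₀) := by
    rcases le_total L (k₀ + 2 * D) with h | h
    · refine ⟨L, le_rfl, hk₀L, h, n, le_rfl, ?_, ?_⟩
      · rw [hL, hg.2.1, wordDist_self]
        exact Nat.zero_le _
      · have h0 : (D : ℝ) ≤ wordDist S (g k₀) (p n) := by exact_mod_cast hout n le_rfl
        rw [hL]
        simp only [gromovProd, hg.2.1, wordDist_self, Nat.cast_zero]
        linarith
    · refine ⟨k₀ + 2 * D, h, by omega, le_rfl, f _, hfn _, hfD _ h, ?_⟩
      have h1 := hg.2.2 k₀ (k₀ + 2 * D) (by omega) (hL ▸ h)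
      have h2 : (D : ℝ) ≤ wordDist S (g k₀) (p (f (k₀ + 2 * D))) := by
        exact_mod_cast hout _ (hfn _)
      have h3 : (wordDist S (g (k₀ + 2 * D)) (p (f (k₀ + 2 * D))) : ℝ) ≤ D := by
        exact_mod_cast hfD _ h
      have h4 : (wordDist S (g k₀) (g (k₀ + 2 * D)) : ℝ) = 2 * D := by
        exact_mod_cast (by omega)
      simp only [gromovProd]
      linarith
  obtain ⟨k₁, hk₁, hk₁', a, ha, hda, hga⟩ := hleft
  obtain ⟨k₂, hk₂L, hk₂, hk₂', b, hb, hdb, hgb⟩ := hright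
  have hdab : (wordDist S (p a) (p b) : ℝ) ≤ 6 * D := by
    have t1 := wordDist_triangle hS (p a) (g k₁) (p b)
    have t2 := wordDist_triangle hS (g k₁) (g k₂) (p b)
    have h := hg.2.2 k₁ k₂ (by omega) (hL ▸ hk₂L)
    rw [wordDist_comm hS (p a) (g k₁)] at t1
    exact_mod_cast (by omega)
  have hpath : ∀ i j, i ≤ j → j ≤ n → (wordDist S (p i) (p j) : ℝ) ≤ 6 * D →
      (D : ℝ) - 1 / 2 - k * η ≤ gromovProd S (p i) (p j) (g k₀) := by
    intro i j hij hj hd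
    have hq := hp.2 i j hij hj
    have hlen : ((j - i : ℕ) : ℝ) ≤ 2 ^ k := by
      refine le_trans ?_ hk
      rw [le_div_iff₀ hlamb, Nat.cast_sub hij]
      linarith
    have h := le_gromovProd_of_path hη p (g k₀) D k i (j - i) (by exact_mod_cast hlen)
      (fun l _ hl => by exact_mod_cast hout l (by omega)) (fun l _ hl => hp.1 l (by omega))
    rwa [Nat.add_sub_cancel' hij] at h
  have hgab : (D : ℝ) - 1 / 2 - k * η ≤ gromovProd S (p a) (p b) (g k₀) := by
    rcases le_total a b with h | h
    · exact hpath a b h hb hdab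
    · rw [gromovProd_comm hS]
      exact hpath b a h ha (by rwa [wordDist_comm hS])
  have hzero : gromovProd S (g k₁) (g k₂) (g k₀) = 0 := by
    have h1 := hg.2.2 k₁ k₀ hk₁ (hL ▸ hk₀L)
    have h2 := hg.2.2 k₀ k₂ hk₂ (hL ▸ hk₂L)
    have h3 := hg.2.2 k₁ k₂ (by omega) (hL ▸ hk₂L)
    have h4 : (wordDist S (g k₁) (g k₂) : ℝ) =
        wordDist S (g k₀) (g k₁) + wordDist S (g k₀) (g k₂) := by
      rw [wordDist_comm hS (g k₀) (g k₁)]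
      exact_mod_cast (by omega)
    simp only [gromovProd]
    linarith
  have m1 := hη (g k₁) (p a) (p b) (g k₀)
  have m2 := hη (g k₁) (p b) (g k₂) (g k₀)
  rw [gromovProd_comm hS (p b) (g k₂)] at m2
  have hkη : 0 ≤ (k : ℝ) * η := by positivity
  have s1 : (D : ℝ) - 1 / 2 - k * η ≤ gromovProd S (g k₁) (p b) (g k₀) + η :=
    le_trans (le_min (by linarith) hgab) m1
  have s2 : (D : ℝ) - 1 / 2 - k * η - η ≤ gromovProd S (g k₁) (g k₂) (g k₀) + η :=
    le_trans (le_min (by linarith) (by linarith)) m2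
  linarith

/-- Every point of a quasigeodesic is almost between its endpoints. -/
theorem exists_gromovProd_quasigeodesic_le (hS : IsSymmGenSet S) (hη0 : 0 ≤ η)
    (hη : FourPointHyperbolic S η) (lamb cb : ℝ) (hlamb : 0 < lamb) (hcb : 0 ≤ cb) :
    ∃ H : ℝ, 0 ≤ H ∧ ∀ (p : ℕ → G) (n : ℕ), IsQuasigeodesicOn S lamb cb p n →
      ∀ t ≤ n, gromovProd S (p 0) (p n) (p t) ≤ H := by
  obtain ⟨H, hH0, hH⟩ := exists_geodesic_near_quasigeodesic hS hη0 hη lamb cb hlamb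
  refine ⟨(2 * H + 1 + cb) / lamb + H, by positivity, fun p n hp t ht => ?_⟩
  obtain ⟨g, hg⟩ := exists_isGeodesic hS (p 0) (p n)
  have hnear := hH p n hp g hg
  obtain ⟨L, hL⟩ : ∃ L, L = wordDist S (p 0) (p n) := ⟨_, rfl⟩
  rw [← hL] at hnear
  -- a point of the geodesic close to the path before time `t`, and to the path after time `t`
  obtain ⟨k, hkL, i, hi, hik, j, hj, hjn, hjk⟩ : ∃ k ≤ L, ∃ i ≤ t,
      (wordDist S (g k) (p i) : ℝ) ≤ H ∧ ∃ j, t ≤ j ∧ j ≤ n ∧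
        (wordDist S (g k) (p j) : ℝ) ≤ H + 1 := by
    by_cases hend : ∃ i ≤ t, (wordDist S (g L) (p i) : ℝ) ≤ H
    · obtain ⟨i, hi, hik⟩ := hend
      refine ⟨L, le_rfl, i, hi, hik, n, ht, le_rfl, ?_⟩
      rw [hL, hg.2.1, wordDist_self, Nat.cast_zero]
      linarith
    · classical
      have hex : ∃ k, ¬ ∃ i ≤ t, (wordDist S (g k) (p i) : ℝ) ≤ H := ⟨L, hend⟩
      have hspec := Nat.find_spec hex
      have hle : Nat.find hex ≤ L := Nat.find_min' hex hend
      have hpos : Nat.find hex ≠ 0 := by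
        intro h0
        rw [h0] at hspec
        exact hspec ⟨0, Nat.zero_le _, by rw [hg.1, wordDist_self, Nat.cast_zero]; exact hH0⟩
      obtain ⟨k, hk⟩ := Nat.exists_eq_succ_of_ne_zero hpos
      rw [hk] at hspec hle
      obtain ⟨i, hi, hik⟩ := not_not.1 (Nat.find_min hex (m := k) (by omega))
      obtain ⟨j, hjn, hjk⟩ := hnear _ hle
      refine ⟨k, by omega, i, hi, hik, j, ?_, hjn, ?_⟩
      · by_contra hlt
        exact hspec ⟨j, by omega, hjk⟩
      · have h1 := hg.2.2 k (k + 1) (by omega) (hL ▸ hle)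
        have h2 := wordDist_triangle_real hS (g k) (g (k + 1)) (p j)
        rw [h1] at h2
        simp only [Nat.add_sub_cancel_left, Nat.cast_one] at h2
        have h3 : (wordDist S (g (k + 1)) (p j) : ℝ) ≤ H := hjk
        linarith
  have hq := hp.2 i j (hi.trans hj) hjn
  have t1 := wordDist_triangle_real hS (p i) (g k) (p j)
  rw [wordDist_comm_real hS (p i) (g k)] at t1
  have hji : (j : ℝ) - i ≤ (2 * H + 1 + cb) / lamb := by
    rw [le_div_iff₀ hlamb]
    linarith
  have hit : (wordDist S (p i) (p t) : ℝ) ≤ t - i := by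
    rw [← Nat.cast_sub hi]
    exact_mod_cast wordDist_le_of_steps hS hp.1 hi ht
  have t2 := wordDist_triangle_real hS (p t) (p i) (g k)
  rw [wordDist_comm_real hS (p t) (p i), wordDist_comm_real hS (p i) (g k)] at t2
  have htj : (t : ℝ) ≤ j := by exact_mod_cast hj
  have hzero : gromovProd S (p 0) (p n) (g k) = 0 := by
    have h1 := hg.dist_left (hL ▸ hkL)
    have h2 := hg.dist_right (hL ▸ hkL)
    have h3 : (wordDist S (p 0) (p n) : ℝ) = wordDist S (g k) (p 0) + wordDist S (g k) (p n) := by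
      rw [wordDist_comm hS (g k) (p 0)]
      exact_mod_cast (by omega)
    simp only [gromovProd]
    linarith
  have h := gromovProd_le_add hS (p 0) (p n) (p t) (g k)
  linarith

end Morse

section Concatenation

variable {G : Type*} [Group G] {S : Set G} {η : ℝ}

theorem sum_le_wordDist_broken_line (hS : IsSymmGenSet S) {C₀ : ℝ} (hη0 : 0 ≤ η) (hC₀ : 0 ≤ C₀)
    (hη : FourPointHyperbolic S η) (x : ℕ → G) (M : ℕ)
    (hlen : ∀ k < M, 2 * (C₀ + η) < wordDist S (x k) (x (k + 1)))
    (hprod : ∀ k, k + 2 ≤ M → gromovProd S (x k) (x (k + 2)) (x (k + 1)) ≤ C₀) :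
    ∑ k ∈ Finset.range M, ((wordDist S (x k) (x (k + 1)) : ℝ) - 2 * (C₀ + η)) ≤
      wordDist S (x 0) (x M) := by
  suffices h : ∀ m ≤ M, ∑ k ∈ Finset.range m,
      ((wordDist S (x k) (x (k + 1)) : ℝ) - 2 * (C₀ + η)) ≤ wordDist S (x 0) (x m) from h M le_rfl
  intro m hm
  induction m with
  | zero => simp
  | succ m ih =>
    have h1 := ih (by omega)
    rw [Finset.sum_range_succ]
    rcases m with _ | m
    · simp only [Finset.range_zero, Finset.sum_empty, zero_add]
      linarith
    · have h2 := gromovProd_broken_line hS hη0 hη x M hlen hprod m hm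
      simp only [gromovProd, wordDist_comm_real hS (x (m + 1)) (x 0)] at h2
      linarith

/-- Points on the first and last pieces of a broken line are about as far apart as the broken line
through the breaking points suggests. -/
theorem le_wordDist_of_near_pieces (hS : IsSymmGenSet S) {C H : ℝ}
    (hη : FourPointHyperbolic S η) (hH : 0 ≤ H) {u P Q V y z : G}
    (hy : gromovProd S u P y ≤ H) (hz : gromovProd S Q V z ≤ H) (hP : gromovProd S u V P ≤ C)
    (hQ : gromovProd S P V Q ≤ C) :
    (wordDist S y P : ℝ) + wordDist S P Q + wordDist S Q z - (8 * C + 6 * η + 6 * H) ≤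
      wordDist S y z := by
  have h1 := gromovProd_le_of_near hS hη hH hy hP
  have h2 : gromovProd S V y Q ≤ C + (C + η + H) := by
    have t := wordDist_triangle_real hS y P Q
    simp only [gromovProd] at h1 hQ ⊢
    linarith [wordDist_comm_real hS Q P, wordDist_comm_real hS P y, wordDist_comm_real hS Q y,
      wordDist_comm_real hS V y]
  rw [gromovProd_comm hS] at hz
  have h3 := gromovProd_le_of_near hS hη hH hz h2
  have t := wordDist_triangle_real hS y Q V
  simp only [gromovProd] at h1 hQ h3
  linarith [wordDist_comm_real hS Q P, wordDist_comm_real hS P y, wordDist_comm_real hS Q y,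
    wordDist_comm_real hS z y]

theorem exists_piece (n : ℕ → ℕ) (N i : ℕ) (hi : i < ∑ j ∈ Finset.range N, n j) :
    ∃ a < N, ∑ j ∈ Finset.range a, n j ≤ i ∧ i < ∑ j ∈ Finset.range (a + 1), n j := by
  induction N with
  | zero => simp at hi
  | succ N ih =>
    rcases lt_or_ge i (∑ j ∈ Finset.range N, n j) with h | h
    · obtain ⟨a, ha, h'⟩ := ih h
      exact ⟨a, by omega, h'⟩
    · exact ⟨N, by omega, h, hi⟩

theorem exists_piece_of_le (n : ℕ → ℕ) (N i : ℕ) (hN : 0 < N)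
    (hi : i ≤ ∑ j ∈ Finset.range N, n j) :
    ∃ a < N, ∑ j ∈ Finset.range a, n j ≤ i ∧ i ≤ ∑ j ∈ Finset.range (a + 1), n j := by
  rcases hi.lt_or_eq with h | h
  · obtain ⟨a, ha, h1, h2⟩ := exists_piece n N i h
    exact ⟨a, ha, h1, h2.le⟩
  · obtain ⟨M, rfl⟩ := Nat.exists_eq_succ_of_ne_zero hN.ne'
    refine ⟨M, by omega, ?_, h.le⟩
    rw [h]
    exact Finset.sum_le_sum_of_subset (Finset.range_mono (Nat.le_succ M))

end Concatenation

/-- **Lemma 2 (broken quasigeodesic lines).** Let `G` be `δ`-hyperbolic with respect to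
a finite symmetrized generating set `S`. Let `λ̄ > 0`, `c̄ ≥ 0`, `C₀ ≥ 14δ` and
`C₁ = 12(C₀ + δ) + c̄ + 1`. Then for `λ = λ̄/4` there exists `c = c(λ̄, c̄, C₀) ≥ 0`
such that: for any `N ≥ 1`, any points `x 0, ..., x N`, and any
`(λ̄, c̄)`-quasigeodesic paths `qᵢ` from `x (i-1)` to `x i` (realized as the segments of
a path `q` between the partial sums `T i = n 0 + ⋯ + n (i-1)` of their lengths), if
`‖qᵢ‖ = n i ≥ (C₁ + c̄)/λ̄` for all `i` and `(x (i-1) | x (i+1))_{x i} ≤ C₀` for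
`1 ≤ i ≤ N - 1`, then the concatenation `q = q₁ q₂ ⋯ q_N` is a `(λ, c)`-quasigeodesic. -/
theorem concatenation_of_quasigeodesics
    {G : Type*} [Group G] (S : Set G) (hS : IsSymmGenSet S)
    (δ : ℝ) (hδ : 0 ≤ δ) (hhyp : ThinTriangles S δ)
    (lamb : ℝ) (hlamb : 0 < lamb) (hlamb1 : lamb ≤ 1) (cb : ℝ) (hcb : 0 ≤ cb)
    (C₀ : ℝ) (hC₀ : 14 * δ ≤ C₀) (C₁ : ℝ) (hC₁ : C₁ = 12 * (C₀ + δ) + cb + 1) :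
    ∃ c : ℝ, 0 ≤ c ∧
      ∀ (N : ℕ), 0 < N → ∀ (x : ℕ → G) (n : ℕ → ℕ) (q : ℕ → G),
        (∀ i ≤ N, q (∑ j ∈ Finset.range i, n j) = x i) →
        (∀ i < N, IsQuasigeodesicOn S lamb cb
          (fun k => q ((∑ j ∈ Finset.range i, n j) + k)) (n i)) →
        (∀ i < N, (C₁ + cb) / lamb ≤ (n i : ℝ)) →
        (∀ i : ℕ, 1 ≤ i → i ≤ N - 1 → gromovProd S (x (i - 1)) (x (i + 1)) (x i) ≤ C₀) →
        IsQuasigeodesicOn S (lamb / 4) c q (∑ j ∈ Finset.range N, n j) := by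
  have hC₀0 : 0 ≤ C₀ := by linarith
  have hη0 : 0 ≤ 2 * δ := by linarith
  have hη := hhyp.fourPoint hS hδ
  obtain ⟨H, hH0, hH⟩ := exists_gromovProd_quasigeodesic_le hS hη0 hη lamb cb hlamb hcb
  refine ⟨8 * (C₀ + 2 * δ) + 6 * (2 * δ) + 6 * H + 2 * cb, by positivity, ?_⟩
  intro N hN x n q hx hq hn hprod
  obtain ⟨T, hT⟩ : ∃ T : ℕ → ℕ, ∀ i, T i = ∑ j ∈ Finset.range i, n j := ⟨_, fun _ => rfl⟩
  have hTs : ∀ i, T (i + 1) = T i + n i := fun i => by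
    rw [hT, hT, Finset.sum_range_succ]
  have hTmono : Monotone T := monotone_nat_of_le_succ fun i => by
    rw [hTs]
    exact Nat.le_add_right _ _
  simp only [← hT] at hx hq ⊢
  have hstep : ∀ i < T N, wordDist S (q i) (q (i + 1)) = 1 := by
    intro i hi
    rw [hT] at hi
    obtain ⟨a, ha, h1, h2⟩ := exists_piece n N i hi
    rw [← hT] at h1 h2
    rw [hTs] at h2
    have h := (hq a ha).1 (i - T a) (by omega)
    simp only [← add_assoc, Nat.add_sub_cancel' h1] at h
    exact h
  have hpiece : ∀ a < N, ∀ i j, T a ≤ i → i ≤ j → j ≤ T (a + 1) →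
      lamb * ((j : ℝ) - i) - cb ≤ wordDist S (q i) (q j) := by
    intro a ha i j hai hij hj
    rw [hTs] at hj
    have h := (hq a ha).2 (i - T a) (j - T a) (by omega) (by omega)
    simp only [Nat.add_sub_cancel' hai, Nat.add_sub_cancel' (hai.trans hij), Nat.cast_sub hai,
      Nat.cast_sub (hai.trans hij)] at h
    linarith
  have hnear : ∀ a < N, ∀ i, T a ≤ i → i ≤ T (a + 1) →
      gromovProd S (x a) (x (a + 1)) (q i) ≤ H := by
    intro a ha i hai hi
    have h := hH _ _ (hq a ha) (i - T a) (by rw [hTs] at hi; omega)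
    simp only [add_zero, Nat.add_sub_cancel' hai, ← hTs] at h
    rwa [hx a ha.le, hx (a + 1) ha] at h
  have hdist : ∀ a < N, lamb * n a - cb ≤ wordDist S (x a) (x (a + 1)) := by
    intro a ha
    have h := hpiece a ha (T a) (T (a + 1)) le_rfl (hTmono (Nat.le_succ a)) le_rfl
    rw [hx a ha.le, hx (a + 1) ha, hTs] at h
    push_cast at h
    linarith
  have hC₁n : ∀ a < N, C₁ + cb ≤ lamb * n a := by
    intro a ha
    have h := hn a ha
    rw [div_le_iff₀ hlamb] at h
    linarith
  have hlen : ∀ a < N, 2 * (C₀ + 2 * δ) < wordDist S (x a) (x (a + 1)) := by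
    intro a ha
    linarith [hdist a ha, hC₁n a ha]
  have hprod' : ∀ a, a + 2 ≤ N → gromovProd S (x a) (x (a + 2)) (x (a + 1)) ≤ C₀ :=
    fun a ha => hprod (a + 1) (by omega) (by omega)
  refine ⟨hstep, fun i j hij hj => ?_⟩
  obtain ⟨a, ha, hai, hia⟩ := exists_piece_of_le n N i hN (by rw [← hT]; omega)
  obtain ⟨b, hb, hbj, hjb⟩ := exists_piece_of_le n N j hN (by rw [← hT]; omega)
  simp only [← hT] at hai hia hbj hjb
  have hij' : (i : ℝ) ≤ j := by exact_mod_cast hij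
  by_cases hsame : j ≤ T (a + 1)
  · have h := hpiece a ha i j hai hij hsame
    nlinarith
  · have hab : a < b := by
      by_contra hba
      have := hTmono (by omega : b + 1 ≤ a + 1)
      omega
    obtain ⟨m, rfl⟩ : ∃ m, b = a + 1 + m := ⟨b - (a + 1), by omega⟩
    have hP : gromovProd S (x a) (x (a + 1 + m + 1)) (x (a + 1)) ≤ C₀ + 2 * δ := by
      have h := gromovProd_broken_line_reverse hS hη0 hη (fun k => x (a + k)) (m + 2)
        (fun k hk => hlen (a + k) (by omega)) (fun k hk => hprod' (a + k) (by omega)) (by omega)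
      have e : a + (m + 2) = a + 1 + m + 1 := by omega
      simpa only [add_zero, e] using h
    have hQ : gromovProd S (x (a + 1)) (x (a + 1 + m + 1)) (x (a + 1 + m)) ≤ C₀ + 2 * δ := by
      rcases m with _ | m
      · have h := gromovProd_le_left hS (x (a + 1)) (x (a + 1 + 0 + 1)) (x (a + 1 + 0))
        rw [add_zero, wordDist_self, Nat.cast_zero] at h
        rw [add_zero]
        linarith
      · exact gromovProd_broken_line hS hη0 hη (fun k => x (a + 1 + k)) (m + 2)
          (fun k hk => hlen (a + 1 + k) (by omega)) (fun k hk => hprod' (a + 1 + k) (by omega))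
          m le_rfl
    have hmain := le_wordDist_of_near_pieces hS hη hH0 (hnear a ha i hai hia)
      (hnear _ hb j hbj hjb) hP hQ
    have hfirst := hpiece a ha i (T (a + 1)) hai hia le_rfl
    rw [hx (a + 1) ha] at hfirst
    have hlast := hpiece _ hb (T (a + 1 + m)) j le_rfl hbj hjb
    rw [hx _ hb.le] at hlast
    have hmiddle : lamb / 4 * ((T (a + 1 + m) : ℝ) - T (a + 1)) ≤
        wordDist S (x (a + 1)) (x (a + 1 + m)) := by
      refine le_trans (le_of_eq ?_) ((Finset.sum_le_sum (f := fun k => lamb / 4 * n (a + 1 + k))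
        fun k hk => ?_).trans (sum_le_wordDist_broken_line hS hη0 hC₀0 hη
          (fun k => x (a + 1 + k)) m (fun k hk => hlen (a + 1 + k) (by omega))
          fun k hk => hprod' (a + 1 + k) (by omega)))
      · rw [← Finset.mul_sum, hT, hT, Finset.sum_range_add]
        push_cast
        ring
      · have hk' : a + 1 + k < N := by
          have := Finset.mem_range.1 hk
          omega
        have h1 := hdist _ hk'
        have h2 := hC₁n _ hk'
        simp only [← add_assoc]
        linarith
    have hia' : (i : ℝ) ≤ T (a + 1) := by exact_mod_cast hia
    have hbj' : (T (a + 1 + m) : ℝ) ≤ j := by exact_mod_cast hbj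
    nlinarith
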